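/- If ρ is a state on C^d ⊗ C^d that is diagonal in a maximally entangled basis, i.e. ρ = Σ_i λ_i P_i where (P_i) is a von Neumann measurement in a maximally entangled basis and (λ_i) is a probability distribution, then the entropic entanglement parameter satisfies M(ρ) ≥ log₂ d − S(ρ). -/

import Mathlib

open Matrix Kronecker BigOperators ComplexOrder

noncomputable section

namespace EEP

/-- `-(x * log₂ x)`; note `Real.logb 2 0 = 0`, giving the convention `0·log₂ 0 = 0`. -/
def negMulLog2 (x : ℝ) : ℝ := -(x * Real.logb 2 x)

/-- Shannon entropy (base 2) of a finite family of reals. -/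
def shannon {n : Type*} [Fintype n] (p : n → ℝ) : ℝ := ∑ i, negMulLog2 (p i)

/-- A quantum state: positive semidefinite (hence Hermitian) matrix with trace 1. -/
def IsState {n : Type*} [Fintype n] [DecidableEq n] (ρ : Matrix n n ℂ) : Prop :=
  ρ.PosSemidef ∧ ρ.trace = 1

/-- A rank-one orthogonal projection matrix. -/
def IsRankOneProj {n : Type*} [Fintype n] [DecidableEq n] (P : Matrix n n ℂ) : Prop :=
  P.IsHermitian ∧ P * P = P ∧ P.rank = 1

/-- A von Neumann measurement on `C^d ⊗ C^d`: a family of `d²` rank-one orthogonal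
projections, mutually orthogonal, summing to the identity. -/
def IsMeasurement {d : ℕ} (P : Fin (d^2) → Matrix (Fin d × Fin d) (Fin d × Fin d) ℂ) : Prop :=
  (∀ i, IsRankOneProj (P i)) ∧ (∀ i j, i ≠ j → P i * P j = 0) ∧ (∑ i, P i) = 1

/-- Klein entropy: Shannon entropy of the outcome distribution `pᵢ = Tr(ρ Pᵢ)`. -/
def kleinEntropy {d : ℕ} (ρ : Matrix (Fin d × Fin d) (Fin d × Fin d) ℂ)
    (P : Fin (d^2) → Matrix (Fin d × Fin d) (Fin d × Fin d) ℂ) : ℝ :=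
  shannon (fun i => (ρ * P i).trace.re)

/-- A product state: Kronecker product of two states on `C^d`. -/
def IsProductState {d : ℕ} (δ : Matrix (Fin d × Fin d) (Fin d × Fin d) ℂ) : Prop :=
  ∃ σA σB : Matrix (Fin d) (Fin d) ℂ, IsState σA ∧ IsState σB ∧ δ = σA ⊗ₖ σB

/-- Infimum of the Klein entropy over product states, for a fixed measurement. -/
def infProd {d : ℕ} (P : Fin (d^2) → Matrix (Fin d × Fin d) (Fin d × Fin d) ℂ) : ℝ :=
  sInf {x : ℝ | ∃ δ, IsProductState δ ∧ x = kleinEntropy δ P}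

/-- The entropic entanglement parameter
`M(ρ) = sup_P ( inf_{δ product} H(δ,P) − H(ρ,P) )`. -/
def eep {d : ℕ} (ρ : Matrix (Fin d × Fin d) (Fin d × Fin d) ℂ) : ℝ :=
  sSup {x : ℝ | ∃ P, IsMeasurement P ∧ x = infProd P - kleinEntropy ρ P}

/-- A separable state: finite convex combination of product states. -/
def IsSeparable {d : ℕ} (ρ : Matrix (Fin d × Fin d) (Fin d × Fin d) ℂ) : Prop :=
  ∃ (m : ℕ) (p : Fin m → ℝ) (δ : Fin m → Matrix (Fin d × Fin d) (Fin d × Fin d) ℂ),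
    (∀ i, 0 ≤ p i) ∧ (∑ i, p i) = 1 ∧ (∀ i, IsProductState (δ i)) ∧
    ρ = ∑ i, (p i : ℂ) • δ i

/-- Rank-one projection `|v⟩⟨v|` onto a vector `v`. -/
def projVec {n : Type*} (v : n → ℂ) : Matrix n n ℂ := Matrix.vecMulVec v (star v)

/-- Coefficient matrix `A` of a vector `ψ ∈ C^d ⊗ C^d`, `A i j = ψ (i,j)`. -/
def coeffMat {d : ℕ} (ψ : Fin d × Fin d → ℂ) : Matrix (Fin d) (Fin d) ℂ :=
  Matrix.of fun i j => ψ (i, j)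

/-- The squared Schmidt coefficients of `ψ`: the eigenvalues of `A Aᴴ`
where `A` is the coefficient matrix of `ψ`. -/
def schmidtSq {d : ℕ} (ψ : Fin d × Fin d → ℂ) : Fin d → ℝ :=
  (Matrix.isHermitian_mul_conjTranspose_self (coeffMat ψ)).eigenvalues

/-- Largest squared Schmidt coefficient (square of the largest singular value of `A`). -/
def maxSchmidtSq {d : ℕ} (ψ : Fin d × Fin d → ℂ) : ℝ := ⨆ i, schmidtSq ψ i

/-- A unit vector. -/
def IsUnitVec {n : Type*} [Fintype n] (ψ : n → ℂ) : Prop := (∑ p, Complex.normSq (ψ p)) = 1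

/-- A maximally entangled unit vector: all squared Schmidt coefficients equal `1/d`. -/
def IsMaxEntVec {d : ℕ} (ψ : Fin d × Fin d → ℂ) : Prop :=
  IsUnitVec ψ ∧ ∀ i, schmidtSq ψ i = 1 / d

/-- A von Neumann measurement in a maximally entangled basis. -/
def IsMaxEntMeasurement {d : ℕ}
    (P : Fin (d^2) → Matrix (Fin d × Fin d) (Fin d × Fin d) ℂ) : Prop :=
  IsMeasurement P ∧ ∀ i, ∃ ψ, IsMaxEntVec ψ ∧ P i = projVec ψ

/-- Von Neumann entropy: Shannon entropy of the eigenvalues. -/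
def vnEntropy {n : Type*} [Fintype n] [DecidableEq n] {ρ : Matrix n n ℂ}
    (h : ρ.IsHermitian) : ℝ := shannon h.eigenvalues

/-- Binary Shannon entropy. -/
def binEnt (x : ℝ) : ℝ := negMulLog2 x + negMulLog2 (1 - x)

open scoped MatrixOrder in
lemma psd_factor {n : Type*} [Fintype n] [DecidableEq n] {X : Matrix n n ℂ} (hX : X.PosSemidef) :
    ∃ B : Matrix n n ℂ, X = Bᴴ * B := by
  obtain ⟨a, ha⟩ := CStarAlgebra.nonneg_iff_eq_star_mul_self.mp hX.nonneg
  exact ⟨a, by simpa [star_eq_conjTranspose] using ha⟩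

lemma trace_re_nonneg {n : Type*} [Fintype n] [DecidableEq n] {X Y : Matrix n n ℂ}
    (hX : X.PosSemidef) (hY : Y.PosSemidef) : 0 ≤ (X * Y).trace.re := by
  obtain ⟨B, rfl⟩ := psd_factor hX
  have h : (Bᴴ * B * Y).trace = (B * Y * Bᴴ).trace := by
    rw [Matrix.mul_assoc, Matrix.trace_mul_comm]
  rw [h]
  exact (Complex.le_def.1 (hY.mul_mul_conjTranspose_same B).trace_nonneg).1

def fsq {m n : Type*} [Fintype m] [Fintype n] (A : Matrix m n ℂ) : ℝ := ∑ i, ∑ j, ‖A i j‖ ^ 2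

lemma trace_re_eq_fsq {m n : Type*} [Fintype m] [Fintype n] (A : Matrix m n ℂ) :
    (Aᴴ * A).trace.re = fsq A := by
  unfold fsq
  rw [Finset.sum_comm]
  simp only [Matrix.trace, Matrix.mul_apply, Matrix.diag_apply, Matrix.conjTranspose_apply,
    Complex.re_sum, ← Complex.normSq_eq_norm_sq, Complex.normSq_apply]
  simp

attribute [local instance] Matrix.frobeniusNormedAddCommGroup in
lemma fsq_eq_norm {m n : Type*} [Fintype m] [Fintype n] (A : Matrix m n ℂ) :
    fsq A = ‖A‖ ^ 2 := by
  rw [Matrix.frobenius_norm_def, ← Real.sqrt_eq_rpow, Real.sq_sqrt (by positivity)]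
  simp [fsq]

attribute [local instance] Matrix.frobeniusNormedAddCommGroup in
lemma fsq_mul_le {l m n : Type*} [Fintype l] [Fintype m] [Fintype n] (A : Matrix l m ℂ)
    (B : Matrix m n ℂ) : fsq (A * B) ≤ fsq A * fsq B := by
  rw [fsq_eq_norm, fsq_eq_norm, fsq_eq_norm, ← mul_pow]
  exact pow_le_pow_left₀ (norm_nonneg _) (Matrix.frobenius_norm_mul A B) 2

lemma trace_mul_le {n : Type*} [Fintype n] [DecidableEq n] {X Y : Matrix n n ℂ}
    (hX : X.PosSemidef) (hY : Y.PosSemidef) :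
    (X * Y).trace.re ≤ X.trace.re * Y.trace.re := by
  obtain ⟨B, rfl⟩ := psd_factor hX
  obtain ⟨C, rfl⟩ := psd_factor hY
  have h : (Bᴴ * B * (Cᴴ * C)).trace = ((B * Cᴴ)ᴴ * (B * Cᴴ)).trace := by
    rw [← Matrix.mul_assoc, Matrix.trace_mul_comm]
    simp [Matrix.mul_assoc]
  have h2 : (Cᴴ * C).trace = (Cᴴᴴ * Cᴴ).trace := by
    rw [Matrix.trace_mul_comm, conjTranspose_conjTranspose]
  rw [h, h2, trace_re_eq_fsq, trace_re_eq_fsq, trace_re_eq_fsq]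
  exact fsq_mul_le _ _

lemma IsRankOneProj.psd {n : Type*} [Fintype n] [DecidableEq n] {P : Matrix n n ℂ}
    (h : IsRankOneProj P) : P.PosSemidef := by
  have := posSemidef_conjTranspose_mul_self P
  rwa [h.1.eq, h.2.1] at this

lemma prob_nonneg {d : ℕ} {P : Fin (d^2) → Matrix (Fin d × Fin d) (Fin d × Fin d) ℂ}
    (hP : IsMeasurement P) {δ : Matrix (Fin d × Fin d) (Fin d × Fin d) ℂ} (hδ : IsState δ) (i) :
    0 ≤ (δ * P i).trace.re := trace_re_nonneg hδ.1 (hP.1 i).psd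

lemma prob_sum {d : ℕ} {P : Fin (d^2) → Matrix (Fin d × Fin d) (Fin d × Fin d) ℂ}
    (hP : IsMeasurement P) {δ : Matrix (Fin d × Fin d) (Fin d × Fin d) ℂ} (hδ : IsState δ) :
    ∑ i, (δ * P i).trace.re = 1 := by
  rw [← Complex.re_sum, ← Matrix.trace_sum, ← Matrix.mul_sum, hP.2.2, Matrix.mul_one, hδ.2]
  simp

lemma prob_le_one {d : ℕ} {P : Fin (d^2) → Matrix (Fin d × Fin d) (Fin d × Fin d) ℂ}
    (hP : IsMeasurement P) {δ : Matrix (Fin d × Fin d) (Fin d × Fin d) ℂ} (hδ : IsState δ) (i) :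
    (δ * P i).trace.re ≤ 1 := by
  rw [← prob_sum hP hδ]
  exact Finset.single_le_sum (f := fun i => (δ * P i).trace.re)
    (fun j _ => prob_nonneg hP hδ j) (Finset.mem_univ i)

lemma nml_eq (x : ℝ) : negMulLog2 x = Real.negMulLog x / Real.log 2 := by
  simp only [negMulLog2, Real.negMulLog, Real.logb]; ring

lemma klein_nonneg {d : ℕ} {P : Fin (d^2) → Matrix (Fin d × Fin d) (Fin d × Fin d) ℂ}
    (hP : IsMeasurement P) {δ : Matrix (Fin d × Fin d) (Fin d × Fin d) ℂ} (hδ : IsState δ) :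
    0 ≤ kleinEntropy δ P := by
  unfold kleinEntropy shannon
  refine Finset.sum_nonneg fun i _ => ?_
  rw [nml_eq]
  exact div_nonneg (Real.negMulLog_nonneg (prob_nonneg hP hδ i) (prob_le_one hP hδ i))
    (Real.log_nonneg (by norm_num))

lemma klein_le {d : ℕ} {P : Fin (d^2) → Matrix (Fin d × Fin d) (Fin d × Fin d) ℂ}
    (hP : IsMeasurement P) {δ : Matrix (Fin d × Fin d) (Fin d × Fin d) ℂ} (hδ : IsState δ) :
    kleinEntropy δ P ≤ ∑ _i : Fin (d^2), 1 / Real.log 2 := by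
  unfold kleinEntropy shannon
  refine Finset.sum_le_sum fun i _ => ?_
  rw [nml_eq]
  have h := Real.negMulLog_le_one_sub_self (prob_nonneg hP hδ i)
  have h0 := prob_nonneg hP hδ i
  exact div_le_div_of_nonneg_right (by linarith) (Real.log_nonneg (by norm_num))

lemma IsProductState.isState {d : ℕ} {δ : Matrix (Fin d × Fin d) (Fin d × Fin d) ℂ}
    (h : IsProductState δ) : IsState δ := by
  obtain ⟨a, b, ha, hb, rfl⟩ := h
  refine ⟨ha.1.kronecker hb.1, ?_⟩
  rw [Matrix.trace_kronecker, ha.2, hb.2, one_mul]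

lemma exists_state {d : ℕ} (hd : 0 < d) : ∃ σ : Matrix (Fin d) (Fin d) ℂ, IsState σ := by
  refine ⟨Matrix.diagonal (Pi.single ⟨0, hd⟩ 1), ?_, ?_⟩
  · rw [Matrix.posSemidef_diagonal_iff]
    intro i
    by_cases h : i = ⟨0, hd⟩
    · subst h; simp
    · simp [Pi.single_apply, h]
  · simp [Matrix.trace_diagonal]

lemma exists_prod {d : ℕ} (hd : 0 < d) :
    ∃ δ : Matrix (Fin d × Fin d) (Fin d × Fin d) ℂ, IsProductState δ := by
  obtain ⟨σ, hσ⟩ := exists_state hd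
  exact ⟨_, σ, σ, hσ, hσ, rfl⟩

lemma infProd_le {d : ℕ} {P : Fin (d^2) → Matrix (Fin d × Fin d) (Fin d × Fin d) ℂ}
    (hP : IsMeasurement P) (hd : 0 < d) : infProd P ≤ ∑ _i : Fin (d^2), 1 / Real.log 2 := by
  obtain ⟨δ, hδ⟩ := exists_prod hd
  refine le_trans ?_ (klein_le hP hδ.isState)
  unfold infProd
  refine csInf_le ⟨0, ?_⟩ ⟨δ, hδ, rfl⟩
  rintro x ⟨δ', h', rfl⟩
  exact klein_nonneg hP h'.isState

lemma coeff_mul {d : ℕ} {ψ : Fin d × Fin d → ℂ} (h : IsMaxEntVec ψ) :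
    coeffMat ψ * (coeffMat ψ)ᴴ = ((1 / d : ℝ) : ℂ) • (1 : Matrix (Fin d) (Fin d) ℂ) := by
  have hh := Matrix.isHermitian_mul_conjTranspose_self (coeffMat ψ)
  have h1 : hh.eigenvalues = fun _ => (1 / d : ℝ) := funext h.2
  rw [hh.spectral_theorem, h1]
  have h2 : (Matrix.diagonal ((RCLike.ofReal : ℝ → ℂ) ∘ fun _ : Fin d => (1 / d : ℝ)))
      = ((1 / d : ℝ) : ℂ) • (1 : Matrix (Fin d) (Fin d) ℂ) := by
    rw [← Matrix.diagonal_one, ← Matrix.diagonal_smul]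
    congr 1
    ext i
    simp
  rw [h2, map_smul, map_one]

lemma trace_prod_proj {d : ℕ} (a b : Matrix (Fin d) (Fin d) ℂ) (ψ : Fin d × Fin d → ℂ) :
    ((a ⊗ₖ b) * projVec ψ).trace = (((coeffMat ψ)ᴴ * a * coeffMat ψ) * bᵀ).trace := by
  simp only [Matrix.trace, Matrix.diag_apply, Matrix.mul_apply, projVec, Matrix.vecMulVec_apply,
    coeffMat, Matrix.conjTranspose_apply, Matrix.of_apply, Matrix.transpose_apply,
    Matrix.kroneckerMap_apply, Pi.star_apply, Fintype.sum_prod_type, Finset.sum_mul]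
  rw [Finset.sum_comm]
  refine Finset.sum_congr rfl fun x _ => ?_
  rw [Finset.sum_congr rfl (fun i _ => Finset.sum_comm), Finset.sum_comm]
  refine Finset.sum_congr rfl fun y _ => ?_
  rw [Finset.sum_comm]
  refine Finset.sum_congr rfl fun z _ => ?_
  refine Finset.sum_congr rfl fun w _ => ?_
  ring

lemma prob_le {d : ℕ} {a b : Matrix (Fin d) (Fin d) ℂ} (ha : IsState a) (hb : IsState b)
    {ψ : Fin d × Fin d → ℂ} (h : IsMaxEntVec ψ) :
    ((a ⊗ₖ b) * projVec ψ).trace.re ≤ 1 / d := by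
  rw [trace_prod_proj]
  refine (trace_mul_le (ha.1.conjTranspose_mul_mul_same _) hb.1.transpose).trans ?_
  have h1 : ((coeffMat ψ)ᴴ * a * coeffMat ψ).trace = ((1 / d : ℝ) : ℂ) := by
    rw [Matrix.trace_mul_comm, ← Matrix.mul_assoc, coeff_mul h]
    simp [ha.2]
  rw [h1, Matrix.trace_transpose, hb.2]
  simp

lemma nml_ge {x : ℝ} {d : ℕ} (hd : 0 < d) (h0 : 0 ≤ x) (h1 : x ≤ 1 / d) :
    x * Real.logb 2 d ≤ negMulLog2 x := by
  rcases h0.eq_or_lt with rfl | h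
  · simp [negMulLog2]
  · have hd' : (0 : ℝ) < d := by exact_mod_cast hd
    have := Real.logb_le_logb_of_le (b := 2) (by norm_num) h h1
    rw [one_div, Real.logb_inv] at this
    unfold negMulLog2
    nlinarith

lemma infProd_ge {d : ℕ} {P : Fin (d^2) → Matrix (Fin d × Fin d) (Fin d × Fin d) ℂ}
    (hP : IsMaxEntMeasurement P) (hd : 0 < d) : Real.logb 2 d ≤ infProd P := by
  obtain ⟨δ, hδ⟩ := exists_prod hd
  refine le_csInf ⟨_, δ, hδ, rfl⟩ ?_
  rintro x ⟨δ, hδ, rfl⟩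
  have hs := hδ.isState
  obtain ⟨a, b, ha, hb, rfl⟩ := hδ
  calc Real.logb 2 d = ∑ i, ((a ⊗ₖ b) * P i).trace.re * Real.logb 2 d := by
        rw [← Finset.sum_mul, prob_sum hP.1 hs, one_mul]
    _ ≤ _ := by
        refine Finset.sum_le_sum fun i _ => nml_ge hd (prob_nonneg hP.1 hs i) ?_
        obtain ⟨ψ, hψ, h⟩ := hP.2 i
        rw [h]
        exact prob_le ha hb hψ

lemma trace_projVec {n : Type*} [Fintype n] {ψ : n → ℂ} (h : IsUnitVec ψ) :
    (projVec ψ).trace = 1 := by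
  have : (projVec ψ).trace = ((∑ p, Complex.normSq (ψ p) : ℝ) : ℂ) := by
    simp [projVec, Matrix.trace, Matrix.vecMulVec_apply, Complex.mul_conj]
  rw [this, h]; simp

lemma klein_eq {d : ℕ} {ρ : Matrix (Fin d × Fin d) (Fin d × Fin d) ℂ}
    {P : Fin (d^2) → Matrix (Fin d × Fin d) (Fin d × Fin d) ℂ}
    (hP : IsMaxEntMeasurement P) (lam : Fin (d^2) → ℝ)
    (hdiag : ρ = ∑ i, (lam i : ℂ) • P i) : kleinEntropy ρ P = shannon lam := by
  unfold kleinEntropy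
  congr 1
  ext i
  have h : ρ * P i = (lam i : ℂ) • P i := by
    rw [hdiag, Finset.sum_mul, Finset.sum_eq_single i]
    · rw [smul_mul_assoc, (hP.1.1 i).2.1]
    · intro j _ hj
      rw [smul_mul_assoc, hP.1.2.1 j i hj, smul_zero]
    · simp
  obtain ⟨ψ, hψ, h'⟩ := hP.2 i
  rw [h, Matrix.trace_smul, h', trace_projVec hψ.1]
  simp

lemma vn_eq {d : ℕ} {ρ : Matrix (Fin d × Fin d) (Fin d × Fin d) ℂ} (hρ : ρ.IsHermitian)
    {P : Fin (d^2) → Matrix (Fin d × Fin d) (Fin d × Fin d) ℂ}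
    (hP : IsMaxEntMeasurement P) (lam : Fin (d^2) → ℝ)
    (hdiag : ρ = ∑ i, (lam i : ℂ) • P i) : vnEntropy hρ = shannon lam := by
  choose ψ hψ hPψ using hP.2
  have hcard : Fintype.card (Fin d × Fin d) = Fintype.card (Fin (d^2)) := by simp [sq]
  let V : Matrix (Fin d × Fin d) (Fin (d^2)) ℂ := Matrix.of fun x i => ψ i x
  let D : Matrix (Fin (d^2)) (Fin (d^2)) ℂ := Matrix.diagonal fun i => (lam i : ℂ)
  have hVV : V * Vᴴ = 1 := by
    rw [← hP.1.2.2]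
    ext x y
    simp [Matrix.sum_apply, hPψ, projVec, Matrix.vecMulVec_apply, V, Matrix.mul_apply]
  have hVV' : Vᴴ * V = 1 := (Matrix.mul_eq_one_comm_of_card_eq _ _ _ hcard).1 hVV
  have hρV : ρ = V * (D * Vᴴ) := by
    rw [hdiag]
    ext x y
    simp only [Matrix.sum_apply, hPψ, projVec, Matrix.vecMulVec_apply, V, D, Matrix.mul_apply (M := Matrix.of _),
      Matrix.smul_apply, Matrix.diagonal_mul, Matrix.of_apply, Matrix.conjTranspose_apply,
      Pi.star_apply, smul_eq_mul]
    exact Finset.sum_congr rfl fun i _ => by ring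
  have hc : ρ.charpoly = D.charpoly := by
    rw [hρV, Matrix.charpoly_mul_comm_of_le _ _ hcard.ge, hcard, Nat.sub_self, pow_zero, one_mul,
      Matrix.mul_assoc, hVV', Matrix.mul_one]
  have hr := hρ.roots_charpoly_eq_eigenvalues
  rw [hc, Matrix.charpoly_diagonal, Polynomial.roots_prod _ _
    (by simp [Finset.prod_ne_zero_iff, Polynomial.X_sub_C_ne_zero])] at hr
  have hm : Multiset.map lam Finset.univ.val = Multiset.map hρ.eigenvalues Finset.univ.val := by
    have h2 := congrArg (Multiset.map Complex.re) hr
    simpa [Multiset.map_map, Function.comp_def] using h2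
  have h3 := congrArg (fun s => (Multiset.map negMulLog2 s).sum) hm
  simp only [Multiset.map_map] at h3
  exact h3.symm

/-- For a state diagonal in a maximally entangled basis, M(ρ) ≥ log₂ d − S(ρ). -/
theorem stmt9 {d : ℕ} (ρ : Matrix (Fin d × Fin d) (Fin d × Fin d) ℂ) (hρ : IsState ρ)
    (P : Fin (d^2) → Matrix (Fin d × Fin d) (Fin d × Fin d) ℂ)
    (hP : IsMaxEntMeasurement P) (lam : Fin (d^2) → ℝ)
    (hl0 : ∀ i, 0 ≤ lam i) (hl1 : (∑ i, lam i) = 1)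
    (hdiag : ρ = ∑ i, (lam i : ℂ) • P i) :
    Real.logb 2 d - vnEntropy hρ.1.1 ≤ eep ρ := by
  have hd : 0 < d := by
    rcases Nat.eq_zero_or_pos d with rfl | h
    · simp at hl1
    · exact h
  rw [vn_eq hρ.1.1 hP lam hdiag, ← klein_eq hP lam hdiag]
  refine le_trans (sub_le_sub_right (infProd_ge hP hd) _) ?_
  unfold eep
  refine le_csSup ⟨∑ _i : Fin (d^2), 1 / Real.log 2, ?_⟩ ⟨P, hP.1, rfl⟩
  · rintro x ⟨Q, hQ, rfl⟩
    have h1 := infProd_le hQ hd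
    have h2 := klein_nonneg hQ hρ
    linarith


end EEP
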